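/- arXiv:funct-an/9707010 — 2 statements merged into one kernel-verified Lean document; each statement's English description precedes it below -/
import Mathlib

section
/- Analytic one-parameter groups are determined by their value at i: if (α_z)_{z∈ℂ} and (β_z)_{z∈ℂ} are analytic one-parameter groups on A relative to φ, with A ≠ {0} and A = span{a·b : a, b ∈ A}, and if α_i = β_i, then α_z = β_z for every z ∈ ℂ. -/
open scoped ComplexOrder

/-- An analytic one-parameter group on a (not necessarily unital) complex `*`-algebra `A`,
relative to a linear functional `φ` : a family `(α z)_{z ∈ ℂ}` of algebra homomorphisms
`A → A` such that each `α t` (`t` real) is a `*`-automorphism, the real group law holds,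
each real `α t` scales `φ` by a strictly positive constant, and all the functions
`z ↦ φ (b * α z a)` and `z ↦ φ (α z a * b)` are entire. -/
structure AnalyticOneParamGroup {A : Type*} [NonUnitalRing A] [Module ℂ A]
    [SMulCommClass ℂ A A] [IsScalarTower ℂ A A] [StarRing A] [StarModule ℂ A]
    (φ : A →ₗ[ℂ] ℂ) (α : ℂ → A → A) : Prop where
  map_add : ∀ (z : ℂ) (a b : A), α z (a + b) = α z a + α z b
  map_smul : ∀ (z : ℂ) (c : ℂ) (a : A), α z (c • a) = c • α z a
  map_mul : ∀ (z : ℂ) (a b : A), α z (a * b) = α z a * α z b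
  real_star : ∀ (t : ℝ) (a : A), α (t : ℂ) (star a) = star (α (t : ℂ) a)
  real_bijective : ∀ t : ℝ, Function.Bijective (α (t : ℂ))
  real_group : ∀ (s t : ℝ) (a : A), α ((s : ℂ) + (t : ℂ)) a = α (s : ℂ) (α (t : ℂ) a)
  real_rel_invariant : ∀ t : ℝ, ∃ c : ℝ, 0 < c ∧ ∀ a : A, φ (α (t : ℂ) a) = (c : ℂ) * φ a
  entire_left : ∀ a b : A, Differentiable ℂ fun z : ℂ => φ (b * α z a)
  entire_right : ∀ a b : A, Differentiable ℂ fun z : ℂ => φ (α z a * b)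

open scoped ComplexConjugate Topology

open Complex Metric

/-- An **Osgood-type lemma** on the diagonal: a separately entire function of two complex
variables which is locally bounded near the diagonal has an entire restriction to it. -/
theorem differentiable_diag_of_locally_bounded {f : ℂ → ℂ → ℂ}
    (h₁ : ∀ w, Differentiable ℂ fun z => f z w) (h₂ : ∀ z, Differentiable ℂ (f z))
    (hb : ∀ z₀ : ℂ, ∃ M : ℝ, ∀ z ∈ ball z₀ 1, ∀ w ∈ ball z₀ 1, ‖f z w‖ ≤ M) :
    Differentiable ℂ fun z => f z z := by
  intro p
  obtain ⟨M, hM⟩ := hb p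
  have hp : p ∈ ball p (1 : ℝ) := mem_ball_self one_pos
  set H : ℂ → ℂ → ℂ := fun z w => f z w - f p w - f z p + f p p with hH
  have H₁ : ∀ w, Differentiable ℂ fun z => H z w := fun w =>
    (((h₁ w).sub_const _).sub (h₁ p)).add_const _
  have H₂ : ∀ z, Differentiable ℂ (H z) := fun z =>
    (((h₂ z).sub (h₂ p)).sub_const _).add_const _
  have hHM : ∀ z ∈ ball p 1, ∀ w ∈ ball p 1, ‖H z w‖ ≤ 4 * M := by
    intro z hz w hw
    have a₁ := norm_add_le (f z w - f p w - f z p) (f p p)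
    have a₂ := norm_sub_le (f z w - f p w) (f z p)
    have a₃ := norm_sub_le (f z w) (f p w)
    have := hM z hz w hw
    have := hM p hp w hw
    have := hM z hz p hp
    have := hM p hp p hp
    simp only [hH]
    linarith
  have Hp₁ : ∀ w, H p w = 0 := fun w => by simp [hH]
  have Hp₂ : ∀ z, H z p = 0 := fun z => by simp [hH]
  have bound₁ : ∀ z ∈ ball p 1, ∀ w ∈ ball p 1, ‖H z w‖ ≤ 4 * M * ‖z - p‖ := by
    intro z hz w hw
    have := dist_le_div_mul_dist_of_mapsTo_ball (R₂ := 4 * M) (H₁ w).differentiableOn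
      (fun x hx => by simpa [Hp₁] using hHM x hx w hw) hz
    simpa [Hp₁, dist_eq_norm] using this
  have bound₂ : ∀ z ∈ ball p 1, ∀ w ∈ ball p 1, ‖H z w‖ ≤ 4 * M * ‖z - p‖ * ‖w - p‖ := by
    intro z hz w hw
    have := dist_le_div_mul_dist_of_mapsTo_ball (R₂ := 4 * M * ‖z - p‖) (H₂ z).differentiableOn
      (fun x hx => by simpa [Hp₂] using bound₁ z hz x hx) hw
    simpa [Hp₂, dist_eq_norm] using this
  have hdiag : HasDerivAt (fun z => H z z) 0 p := by
    rw [hasDerivAt_iff_isLittleO]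
    have hO : (fun z => H z z) =O[𝓝 p] fun z => ‖z - p‖ ^ 2 := by
      refine Asymptotics.IsBigO.of_bound (4 * M) ?_
      filter_upwards [ball_mem_nhds p one_pos] with z hz
      simpa [pow_two, mul_assoc] using bound₂ z hz z hz
    have ho : (fun z : ℂ => ‖z - p‖ ^ 2) =o[𝓝 p] fun z => z - p :=
      Asymptotics.isLittleO_pow_sub_sub p one_lt_two
    simpa [Hp₁] using hO.trans_isLittleO ho
  have hf : (fun z => f z z) = fun z => H z z + f p z + f z p - f p p := by
    funext z
    simp only [hH]
    ring
  rw [hf]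
  exact ((hdiag.differentiableAt.add (h₂ p p)).add (h₁ p p)).sub_const _

theorem Differentiable.eq_of_forall_ofReal_eq {f g : ℂ → ℂ} (hf : Differentiable ℂ f)
    (hg : Differentiable ℂ g) (h : ∀ t : ℝ, f t = g t) (z : ℂ) : f z = g z := by
  have hfr : ∃ᶠ z in 𝓝[≠] (0 : ℂ), f z = g z := by
    have hmap : Filter.Tendsto (fun t : ℝ => (t : ℂ)) (𝓝[≠] 0) (𝓝[≠] (0 : ℂ)) := by
      refine tendsto_nhdsWithin_iff.2 ⟨?_, ?_⟩
      · exact (continuous_ofReal.tendsto' 0 0 (by simp)).mono_left nhdsWithin_le_nhds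
      · filter_upwards [self_mem_nhdsWithin] with t ht
        simpa using ht
    exact hmap.frequently (Filter.Frequently.of_forall h)
  exact congrFun (AnalyticOnNhd.eq_of_frequently_eq (fun x _ => hf.analyticAt x)
    (fun x _ => hg.analyticAt x) hfr) z

theorem eq_of_forall_map_mul_eq {A : Type*} [NonUnitalRing A] [Module ℂ A] [StarRing A]
    {φ : A →ₗ[ℂ] ℂ} (hfaith : ∀ a : A, φ (star a * a) = 0 → a = 0) {x y : A}
    (h : ∀ b, φ (b * x) = φ (b * y)) : x = y := by
  refine sub_eq_zero.1 (hfaith _ ?_)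
  rw [mul_sub, map_sub, h, sub_self]

section PositiveFunctional

variable {A : Type*} [NonUnitalRing A] [Module ℂ A] [SMulCommClass ℂ A A] [IsScalarTower ℂ A A]
  [StarRing A] [StarModule ℂ A] {φ : A →ₗ[ℂ] ℂ}

/-- A positive functional on a complex `*`-algebra is hermitian on products. -/
theorem map_star_mul_eq_conj (hpos : ∀ a : A, 0 ≤ φ (star a * a)) (a b : A) :
    φ (star b * a) = conj (φ (star a * b)) := by
  have him : ∀ x : A, (φ (star x * x)).im = 0 := fun x => ((le_def.1 (hpos x)).2).symm
  have h₁ := him (a + b)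
  have h₂ := him (a + I • b)
  have ha := him a
  have hb := him b
  simp only [star_add, star_smul, add_mul, mul_add, map_add, smul_mul_assoc, mul_smul_comm,
    map_smul, smul_eq_mul, add_im, mul_im, mul_re, star_def, conj_I, neg_re, neg_im, I_re, I_im]
    at h₁ h₂
  apply Complex.ext
  · simp only [conj_re]
    linarith
  · simp only [conj_im]
    linarith

/-- The pre-inner product `⟪a, b⟫ = φ (a⋆ b)` of a positive functional. -/
noncomputable abbrev preInnerCoreOfPositive (φ : A →ₗ[ℂ] ℂ)
    (hpos : ∀ a : A, 0 ≤ φ (star a * a)) : PreInnerProductSpace.Core ℂ A where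
  inner a b := φ (star a * b)
  conj_inner_symm a b := (map_star_mul_eq_conj hpos b a).symm
  re_inner_nonneg a := (le_def.1 (hpos a)).1
  add_left a b c := by simp [add_mul]
  smul_left a b r := by simp [smul_mul_assoc]

theorem map_star_eq_conj_mul (hpos : ∀ a : A, 0 ≤ φ (star a * a)) (a b : A) :
    φ (a * star b) = conj (φ (b * star a)) := by
  simpa using map_star_mul_eq_conj hpos (star b) (star a)

/-- The Cauchy–Schwarz inequality for a positive functional. -/
theorem norm_map_mul_sq_le (hpos : ∀ a : A, 0 ≤ φ (star a * a)) (x y : A) :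
    ‖φ (x * y)‖ ^ 2 ≤ ‖φ (x * star x)‖ * ‖φ (star y * y)‖ := by
  let core := preInnerCoreOfPositive φ hpos
  let inner₀ : Inner ℂ A := core.toInner
  have h := InnerProductSpace.Core.inner_mul_inner_self_le (𝕜 := ℂ) (F := A) (star x) y
  have e : ∀ a b : A, inner ℂ a b = φ (star a * b) := fun _ _ => rfl
  have hs : ‖φ (star y * star x)‖ = ‖φ (x * y)‖ := by
    rw [map_star_mul_eq_conj hpos]
    simp
  simp only [e, star_star, hs] at h
  calc ‖φ (x * y)‖ ^ 2 = ‖φ (x * y)‖ * ‖φ (x * y)‖ := pow_two _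
    _ ≤ _ := h
    _ ≤ _ := by
      have h₁ := re_le_norm (φ (x * star x))
      have h₂ := re_le_norm (φ (star y * y))
      have h₃ : 0 ≤ (φ (star y * y)).re := (le_def.1 (hpos y)).1
      exact mul_le_mul h₁ h₂ h₃ (norm_nonneg _)

end PositiveFunctional

namespace AnalyticOneParamGroup

variable {A : Type*} [NonUnitalRing A] [Module ℂ A] [SMulCommClass ℂ A A] [IsScalarTower ℂ A A]
  [StarRing A] [StarModule ℂ A] {φ : A →ₗ[ℂ] ℂ} {α : ℂ → A → A}

theorem zero_apply (hα : AnalyticOneParamGroup φ α) (a : A) : α 0 a = a := by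
  have hinj := (hα.real_bijective 0).1
  apply hinj
  have := hα.real_group 0 0 a
  simpa using this.symm

theorem map_zero (hα : AnalyticOneParamGroup φ α) (z : ℂ) : α z 0 = 0 := by
  simpa using hα.map_smul z 0 0

theorem apply_neg_apply_ofReal (hα : AnalyticOneParamGroup φ α) (t : ℝ) (a : A) :
    α t (α (-t) a) = a := by
  have := hα.real_group t (-t) a
  simpa [hα.zero_apply] using this.symm

/-- The scaling constants of `φ` under an analytic one-parameter group form an exponential. -/
theorem exists_scale (hα : AnalyticOneParamGroup φ α)
    (hfaith : ∀ a : A, φ (star a * a) = 0 → a = 0) (hA : ∃ a : A, a ≠ 0) :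
    ∃ c : ℝ, ∀ (t : ℝ) (a : A), φ (α t a) = exp (c * t) * φ a := by
  obtain ⟨x, hx⟩ := hA
  have hx' : φ (star x * x) ≠ 0 := fun h => hx (hfaith x h)
  choose l hl0 hl using hα.real_rel_invariant
  have l_add : ∀ s t, l (s + t) = l s * l t := by
    intro s t
    have h := hl (s + t) (star x * x)
    rw [ofReal_add, hα.real_group, hl, hl, ← mul_assoc] at h
    exact_mod_cast (mul_right_cancel₀ hx' h).symm
  have key : ∀ t : ℝ, φ (star x * α t x) = l t * φ (α (-(t : ℂ)) (star x) * x) := by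
    intro t
    rw [← hl, hα.map_mul, hα.apply_neg_apply_ofReal]
  let L : ℝ →+ ℝ := AddMonoidHom.mk' (fun t => Real.log (l t)) fun s t => by
    simp only [l_add, Real.log_mul (hl0 s).ne' (hl0 t).ne']
  have hLe : ∀ t, Real.exp (L t) = l t := fun t => Real.exp_log (hl0 t)
  have hnum : Continuous fun t : ℝ => φ (star x * α t x) :=
    (hα.entire_left x (star x)).continuous.comp continuous_ofReal
  have hden : Continuous fun t : ℝ => φ (α (-(t : ℂ)) (star x) * x) :=
    (hα.entire_right (star x) x).continuous.comp continuous_ofReal.neg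
  have hden0 : φ (α (-((0 : ℝ) : ℂ)) (star x) * x) ≠ 0 := by
    simpa [hα.zero_apply] using hx'
  have hlc : ContinuousAt l 0 := by
    have hq : ContinuousAt (fun t : ℝ =>
        (φ (star x * α t x) / φ (α (-(t : ℂ)) (star x) * x)).re) 0 :=
      continuous_re.continuousAt.comp (hnum.continuousAt.div hden.continuousAt hden0)
    refine hq.congr ?_
    filter_upwards [hden.continuousAt.eventually_ne hden0] with t ht
    rw [key, mul_div_cancel_right₀ _ ht, ofReal_re]
  have hLc : Continuous L :=
    continuous_of_continuousAt_zero L (hlc.log (hl0 0).ne')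
  refine ⟨L 1, fun t a => ?_⟩
  have hLt : L t = L 1 * t := by
    have := map_real_smul L hLc t 1
    simpa [mul_comm] using this
  rw [hl, ← hLe, hLt]
  push_cast
  rfl

variable {c : ℝ}

theorem map_mul_apply (hα : AnalyticOneParamGroup φ α)
    (hc : ∀ (t : ℝ) (a : A), φ (α t a) = exp (c * t) * φ a) (z : ℂ) (a b : A) :
    φ (b * α z a) = exp (c * z) * φ (α (-z) b * a) := by
  refine Differentiable.eq_of_forall_ofReal_eq (hα.entire_left a b)
    (g := fun z => exp (c * z) * φ (α (-z) b * a)) ?_ (fun t => ?_) z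
  · have := (hα.entire_right b a).comp differentiable_neg
    exact Differentiable.mul (by fun_prop) this
  · rw [← hc, hα.map_mul, hα.apply_neg_apply_ofReal]

theorem apply_add_ofReal
    (hfaith : ∀ a : A, φ (star a * a) = 0 → a = 0)
    (hα : AnalyticOneParamGroup φ α) (z : ℂ) (s : ℝ) (a : A) :
    α (z + s) a = α z (α s a) := by
  refine eq_of_forall_map_mul_eq hfaith fun b => ?_
  refine Differentiable.eq_of_forall_ofReal_eq
    ((hα.entire_left a b).comp (differentiable_id.add_const (s : ℂ)))
    (hα.entire_left (α s a) b) (fun t => ?_) z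
  simp [hα.real_group]

/-- The group law extends to complex parameters. -/
theorem apply_add
    (hfaith : ∀ a : A, φ (star a * a) = 0 → a = 0) (hα : AnalyticOneParamGroup φ α)
    (hc : ∀ (t : ℝ) (a : A), φ (α t a) = exp (c * t) * φ a) (z w : ℂ) (a : A) :
    α (z + w) a = α z (α w a) := by
  refine eq_of_forall_map_mul_eq hfaith fun b => ?_
  rw [hα.map_mul_apply hc z]
  refine Differentiable.eq_of_forall_ofReal_eq
    ((hα.entire_left a b).comp (differentiable_id.const_add z))
    (g := fun w => exp (c * z) * φ (α (-z) b * α w a))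
    ((hα.entire_left a (α (-z) b)).const_mul _) (fun t => ?_) w
  simp [hα.apply_add_ofReal hfaith, hα.map_mul_apply hc z]

theorem apply_neg_apply
    (hfaith : ∀ a : A, φ (star a * a) = 0 → a = 0) (hα : AnalyticOneParamGroup φ α)
    (hc : ∀ (t : ℝ) (a : A), φ (α t a) = exp (c * t) * φ a) (z : ℂ) (a : A) :
    α (-z) (α z a) = a := by
  rw [← hα.apply_add hfaith hc, neg_add_cancel, hα.zero_apply]

theorem apply_star
    (hfaith : ∀ a : A, φ (star a * a) = 0 → a = 0)
    (hα : AnalyticOneParamGroup φ α) (hpos : ∀ a : A, 0 ≤ φ (star a * a))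
    (z : ℂ) (a : A) : α z (star a) = star (α (conj z) a) := by
  refine eq_of_forall_map_mul_eq hfaith fun b => ?_
  refine Differentiable.eq_of_forall_ofReal_eq (hα.entire_left (star a) b)
    (g := fun z => φ (b * star (α (conj z) a))) ?_ (fun t => ?_) z
  · have : (fun z => φ (b * star (α (conj z) a))) =
        conj ∘ (fun z => φ (α z a * star b)) ∘ conj := by
      funext z
      exact map_star_eq_conj_mul hpos _ _
    rw [this]
    intro z
    simpa using (hα.entire_right a (star b) (conj z)).conj_conj
  · simp [hα.real_star]

theorem map_apply_mul_apply
    (hfaith : ∀ a : A, φ (star a * a) = 0 → a = 0) (hα : AnalyticOneParamGroup φ α)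
    (hc : ∀ (t : ℝ) (a : A), φ (α t a) = exp (c * t) * φ a) (z w : ℂ) (a b : A) :
    φ (α z b * α w a) = exp (c * z) * φ (b * α (w - z) a) := by
  have h : α w a = α z (α (w - z) a) := by
    rw [← hα.apply_add hfaith hc, add_sub_cancel]
  rw [h, hα.map_mul_apply hc z, hα.apply_neg_apply hfaith hc]

end AnalyticOneParamGroup

section Comparison

variable {A : Type*} [NonUnitalRing A] [Module ℂ A] [SMulCommClass ℂ A A] [IsScalarTower ℂ A A]
  [StarRing A] [StarModule ℂ A] {φ : A →ₗ[ℂ] ℂ} {α β : ℂ → A → A} {c d : ℝ}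

theorem norm_map_apply_mul_apply_sq_le (hpos : ∀ a : A, 0 ≤ φ (star a * a))
    (hfaith : ∀ a : A, φ (star a * a) = 0 → a = 0)
    (hα : AnalyticOneParamGroup φ α) (hβ : AnalyticOneParamGroup φ β)
    (hc : ∀ (t : ℝ) (a : A), φ (α t a) = exp (c * t) * φ a)
    (hd : ∀ (t : ℝ) (a : A), φ (β t a) = exp (d * t) * φ a) (z w : ℂ) (a b : A) :
    ‖φ (β z b * α w a)‖ ^ 2 ≤
      (Real.exp (d * z.re) * ‖φ (b * β (conj z - z) (star b))‖) *
        (Real.exp (c * w.re) * ‖φ (star a * α (w - conj w) a)‖) := by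
  refine (norm_map_mul_sq_le hpos _ _).trans_eq ?_
  have h₁ : star (β z b) = β (conj z) (star b) := by
    rw [hβ.apply_star hfaith hpos, conj_conj]
  have h₂ : star (α w a) = α (conj w) (star a) := by
    rw [hα.apply_star hfaith hpos, conj_conj]
  rw [h₁, h₂, hβ.map_apply_mul_apply hfaith hd, hα.map_apply_mul_apply hfaith hc]
  simp [norm_exp]

theorem differentiable_map_apply_mul_apply (hpos : ∀ a : A, 0 ≤ φ (star a * a))
    (hfaith : ∀ a : A, φ (star a * a) = 0 → a = 0)
    (hα : AnalyticOneParamGroup φ α) (hβ : AnalyticOneParamGroup φ β)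
    (hc : ∀ (t : ℝ) (a : A), φ (α t a) = exp (c * t) * φ a)
    (hd : ∀ (t : ℝ) (a : A), φ (β t a) = exp (d * t) * φ a) (a b : A) :
    Differentiable ℂ fun z => φ (β z b * α z a) := by
  refine differentiable_diag_of_locally_bounded (f := fun z w => φ (β z b * α w a))
    (fun w => hβ.entire_right b (α w a)) (fun z => hα.entire_left a (β z b)) fun p => ?_
  have hcβ := (hβ.entire_left (star b) b).continuous
  have hcα := (hα.entire_left a (star a)).continuous
  have hcont : Continuous fun q : ℂ × ℂ =>
      (Real.exp (d * q.1.re) * ‖φ (b * β (conj q.1 - q.1) (star b))‖) *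
        (Real.exp (c * q.2.re) * ‖φ (star a * α (q.2 - conj q.2) a)‖) := by
    have e₁ : Continuous fun q : ℂ × ℂ => φ (b * β (conj q.1 - q.1) (star b)) :=
      hcβ.comp (by fun_prop)
    have e₂ : Continuous fun q : ℂ × ℂ => φ (star a * α (q.2 - conj q.2) a) :=
      hcα.comp (by fun_prop)
    have e₃ : Continuous fun q : ℂ × ℂ => Real.exp (d * q.1.re) :=
      Real.continuous_exp.comp ((continuous_re.comp continuous_fst).const_mul d)
    have e₄ : Continuous fun q : ℂ × ℂ => Real.exp (c * q.2.re) :=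
      Real.continuous_exp.comp ((continuous_re.comp continuous_snd).const_mul c)
    exact (e₃.mul e₁.norm).mul (e₄.mul e₂.norm)
  obtain ⟨M, hM⟩ := ((isCompact_closedBall p 1).prod
    (isCompact_closedBall p 1)).bddAbove_image hcont.continuousOn
  refine ⟨Real.sqrt M, fun z hz w hw => Real.le_sqrt_of_sq_le ?_⟩
  refine (norm_map_apply_mul_apply_sq_le hpos hfaith hα hβ hc hd z w a b).trans
    (hM ⟨(z, w), ⟨ball_subset_closedBall hz, ball_subset_closedBall hw⟩, rfl⟩)

/-- If `α` and `β` agree at `i`, then `z ↦ φ (β z b * α z a)` is an exponential: after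
normalisation it is entire, and its modulus is bounded and `i`-periodic. -/
theorem map_apply_mul_apply_eq_exp (hpos : ∀ a : A, 0 ≤ φ (star a * a))
    (hfaith : ∀ a : A, φ (star a * a) = 0 → a = 0)
    (hα : AnalyticOneParamGroup φ α) (hβ : AnalyticOneParamGroup φ β)
    (hc : ∀ (t : ℝ) (a : A), φ (α t a) = exp (c * t) * φ a)
    (hd : ∀ (t : ℝ) (a : A), φ (β t a) = exp (d * t) * φ a) (hI : α I = β I)
    (z : ℂ) (a b : A) :
    φ (β z b * α z a) = exp (((c + d) / 2 : ℝ) * z) * φ (b * a) := by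
  set r : ℝ := (c + d) / 2 with hr
  set K : ℂ → ℂ := fun z => exp (-(r * z)) * φ (β z b * α z a) with hK
  have hKd : Differentiable ℂ K := Differentiable.mul (by fun_prop)
    (differentiable_map_apply_mul_apply hpos hfaith hα hβ hc hd a b)
  have hper : Function.Periodic (fun z => ‖K z‖) I := by
    intro z
    have h : φ (β (z + I) b * α (z + I) a) = exp (c * I) * φ (β z b * α z a) := by
      rw [add_comm z I, hβ.apply_add hfaith hd, hα.apply_add hfaith hc, ← hI,
        hα.map_apply_mul_apply hfaith hc, sub_self, hα.zero_apply]
    simp only [hK, h, norm_mul, norm_exp]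
    simp
  let N : ℝ → ℝ := fun y => ‖φ (b * β (-(2 * y * I)) (star b))‖ * ‖φ (star a * α (2 * y * I) a)‖
  have hN : Continuous N := by
    have e₁ : Continuous fun y : ℝ => φ (b * β (-(2 * y * I)) (star b)) :=
      (hβ.entire_left (star b) b).continuous.comp (by fun_prop)
    have e₂ : Continuous fun y : ℝ => φ (star a * α (2 * y * I) a) :=
      (hα.entire_left a (star a)).continuous.comp (by fun_prop)
    exact e₁.norm.mul e₂.norm
  have hKN : ∀ z, ‖K z‖ ^ 2 ≤ N z.im := by
    intro z
    have h := norm_map_apply_mul_apply_sq_le hpos hfaith hα hβ hc hd z z a b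
    have e₁ : z - conj z = 2 * z.im * I := by
      rw [sub_conj]
      push_cast
      ring
    have e₂ : conj z - z = -(2 * z.im * I) := by rw [← e₁, neg_sub]
    rw [e₁, e₂] at h
    have hexp : Real.exp (-(r * z.re)) ^ 2 * (Real.exp (d * z.re) * Real.exp (c * z.re)) = 1 := by
      rw [pow_two, ← Real.exp_add, ← Real.exp_add, ← Real.exp_add, Real.exp_eq_one_iff, hr]
      ring
    calc ‖K z‖ ^ 2 = Real.exp (-(r * z.re)) ^ 2 * ‖φ (β z b * α z a)‖ ^ 2 := by
          simp [hK, norm_exp, mul_pow]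
      _ ≤ _ := mul_le_mul_of_nonneg_left h (sq_nonneg _)
      _ = (Real.exp (-(r * z.re)) ^ 2 * (Real.exp (d * z.re) * Real.exp (c * z.re))) *
          N z.im := by simp only [N]; ring
      _ = N z.im := by rw [hexp, one_mul]
  obtain ⟨M, hM⟩ := (isCompact_Icc (a := (0 : ℝ)) (b := 1)).bddAbove_image hN.continuousOn
  have hbdd : Bornology.IsBounded (Set.range K) := by
    refine isBounded_iff_forall_norm_le.2 ⟨Real.sqrt M, ?_⟩
    rintro _ ⟨z, rfl⟩
    have hz := hper.sub_int_mul_eq (x := z) ⌊z.im⌋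
    rw [← hz]
    refine Real.le_sqrt_of_sq_le ((hKN _).trans (hM ⟨_, ?_, rfl⟩))
    simpa using (Int.fract_lt_one z.im).le
  have hconst := hKd.apply_eq_apply_of_bounded hbdd z 0
  simp only [hK, hα.zero_apply, hβ.zero_apply, mul_zero, neg_zero, exp_zero, one_mul] at hconst
  rw [← hconst, ← mul_assoc, ← exp_add, add_neg_cancel, exp_zero, one_mul]

end Comparison

/-- Analytic one-parameter groups are determined by their value at `i` : if `A ≠ {0}`, `A` is
spanned by products and `α i = β i`, then `α = β`. -/
theorem analyticOneParamGroup_eq_of_eq_at_I {A : Type*} [NonUnitalRing A] [Module ℂ A]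
    [SMulCommClass ℂ A A] [IsScalarTower ℂ A A] [StarRing A] [StarModule ℂ A]
    (φ : A →ₗ[ℂ] ℂ)
    (hpos : ∀ a : A, 0 ≤ φ (star a * a))
    (hfaith : ∀ a : A, φ (star a * a) = 0 → a = 0)
    (α : ℂ → A → A) (hα : AnalyticOneParamGroup φ α)
    (β : ℂ → A → A) (hβ : AnalyticOneParamGroup φ β)
    (hA : ∃ a : A, a ≠ 0)
    (hspan : Submodule.span ℂ {x : A | ∃ a b : A, x = a * b} = ⊤)
    (hI : α Complex.I = β Complex.I) :
    ∀ z : ℂ, α z = β z := by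
  intro z
  obtain ⟨c, hc⟩ := hα.exists_scale hfaith hA
  obtain ⟨d, hd⟩ := hβ.exists_scale hfaith hA
  obtain ⟨k, hk0, hk⟩ : ∃ k : ℂ, k ≠ 0 ∧ ∀ a, α z a = k • β z a := by
    refine ⟨exp (((c + d) / 2 : ℝ) * z) * exp (d * -z),
      mul_ne_zero (exp_ne_zero _) (exp_ne_zero _), fun a => ?_⟩
    refine eq_of_forall_map_mul_eq hfaith fun b => ?_
    have hb : β z (β (-z) b) = b := by simpa using hβ.apply_neg_apply hfaith hd (-z) b
    have h := map_apply_mul_apply_eq_exp hpos hfaith hα hβ hc hd hI z a (β (-z) b)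
    have h' := hβ.map_apply_mul_apply hfaith hd (-z) 0 a b
    rw [hβ.zero_apply, zero_sub, neg_neg] at h'
    rw [hb, h'] at h
    rw [h, mul_smul_comm, map_smul, smul_eq_mul, mul_assoc]
  obtain ⟨x, hx⟩ := hA
  have hy : star x * x ≠ 0 := fun h => hx (hfaith x (by rw [h, map_zero]))
  have hβy : β z (star x * x) ≠ 0 := fun h => hy (by
    rw [← hβ.apply_neg_apply hfaith hd z (star x * x), h, hβ.map_zero])
  have hkk : (k * k) • β z (star x * x) = k • β z (star x * x) := by
    rw [← hk, hα.map_mul, hk, hk, hβ.map_mul, smul_mul_smul_comm]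
  have hk1 : k = 1 := by
    have h : (k * (k - 1)) • β z (star x * x) = 0 := by
      rw [mul_sub, mul_one, sub_smul, hkk, sub_self]
    rcases smul_eq_zero.1 h with h | h
    · exact sub_eq_zero.1 ((mul_eq_zero.1 h).resolve_left hk0)
    · exact absurd h hβy
  funext a
  rw [hk, hk1, one_smul]
end

section
/- Let (u_z)_{z∈ℂ} be an analytic unitary representation on A. Then for every z ∈ ℂ one has (u_z)* = u_{-conj(z)}. -/
open scoped ComplexOrder

/-- An analytic unitary representation on a unital complex `*`-algebra `A` : a family
`(u z)_{z ∈ ℂ}` of elements of `A` such that `u t` is unitary for every real `t`, the real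
group law holds, and the functions `z ↦ φ (a * u z)` and `z ↦ φ (u z * a)` are entire. -/
structure AnalyticUnitaryRep {A : Type*} [Ring A] [Algebra ℂ A] [StarRing A]
    [StarModule ℂ A] (φ : A →ₗ[ℂ] ℂ) (u : ℂ → A) : Prop where
  real_unitary : ∀ t : ℝ, star (u (t : ℂ)) * u (t : ℂ) = 1 ∧ u (t : ℂ) * star (u (t : ℂ)) = 1
  real_group : ∀ s t : ℝ, u ((s : ℂ) + (t : ℂ)) = u (s : ℂ) * u (t : ℂ)
  entire_left : ∀ a : A, Differentiable ℂ fun z : ℂ => φ (a * u z)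
  entire_right : ∀ a : A, Differentiable ℂ fun z : ℂ => φ (u z * a)

/-- A positive linear functional on a unital complex `*`-algebra is hermitian. -/
theorem map_star_of_nonneg {A : Type*} [Ring A] [Algebra ℂ A] [StarRing A] [StarModule ℂ A]
    (φ : A →ₗ[ℂ] ℂ) (hpos : ∀ a : A, 0 ≤ φ (star a * a)) (a : A) :
    φ (star a) = starRingEnd ℂ (φ a) := by
  have him : ∀ b : A, (φ (star b * b)).im = 0 := fun b =>
    (Complex.nonneg_iff.mp (hpos b)).2.symm
  have h_one : (φ 1).im = 0 := by simpa using him 1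
  have h_real := him (1 + a)
  have h_imag := him (1 + Complex.I • a)
  have h_self := him a
  simp only [star_add, star_one, star_smul, add_mul, mul_add, one_mul, mul_one, smul_mul_assoc,
    mul_smul_comm, map_add, map_smul, Complex.add_im, smul_eq_mul, Complex.star_def,
    Complex.conj_I, Complex.mul_im, Complex.mul_re, Complex.neg_re, Complex.neg_im, Complex.I_re,
    Complex.I_im, h_one, h_self] at h_real h_imag
  apply Complex.ext
  · simp only [Complex.conj_re]
    linarith
  · simp only [Complex.conj_im]
    linarith

/-- Two entire functions that agree on the real line are equal. -/
theorem Differentiable.eq_of_eq_ofReal {f g : ℂ → ℂ} (hf : Differentiable ℂ f)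
    (hg : Differentiable ℂ g) (h : ∀ t : ℝ, f t = g t) : f = g := by
  refine AnalyticOnNhd.eq_of_frequently_eq (z₀ := 0) (fun z _ => hf.analyticAt z)
    (fun z _ => hg.analyticAt z) ?_
  have htend : Filter.Tendsto (fun t : ℝ => (t : ℂ)) (nhdsWithin 0 {0}ᶜ) (nhdsWithin 0 {0}ᶜ) := by
    refine tendsto_nhdsWithin_iff.mpr ⟨?_, ?_⟩
    · simpa using (Complex.continuous_ofReal.tendsto 0).mono_left nhdsWithin_le_nhds
    · filter_upwards [self_mem_nhdsWithin] with t ht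
      simpa using ht
  exact htend.frequently (Filter.Frequently.of_forall h)

namespace AnalyticUnitaryRep

variable {A : Type*} [Ring A] [Algebra ℂ A] [StarRing A] [StarModule ℂ A]
  {φ : A →ₗ[ℂ] ℂ} {u : ℂ → A}

theorem apply_zero (hu : AnalyticUnitaryRep φ u) : u 0 = 1 := by
  have hstar := (hu.real_unitary 0).1
  have hmul := hu.real_group 0 0
  simp only [Complex.ofReal_zero, add_zero] at hstar hmul
  calc u 0 = star (u 0) * u 0 * u 0 := by rw [hstar, one_mul]
    _ = 1 := by rw [mul_assoc, ← hmul, hstar]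

theorem star_neg_ofReal (hu : AnalyticUnitaryRep φ u) (t : ℝ) : star (u (-(t : ℂ))) = u t := by
  have hstar := (hu.real_unitary (-t)).1
  have hmul := hu.real_group (-t) t
  simp only [Complex.ofReal_neg, neg_add_cancel, hu.apply_zero] at hstar hmul
  exact left_inv_eq_right_inv hstar hmul.symm

end AnalyticUnitaryRep

/-- For an analytic unitary representation `u` one has `(u z)* = u (-conj z)`. -/
theorem analyticUnitaryRep_star {A : Type*} [Ring A] [Algebra ℂ A] [StarRing A] [StarModule ℂ A]
    (φ : A →ₗ[ℂ] ℂ)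
    (hpos : ∀ a : A, 0 ≤ φ (star a * a))
    (hfaith : ∀ a : A, φ (star a * a) = 0 → a = 0)
    (u : ℂ → A) (hu : AnalyticUnitaryRep φ u)
    (z : ℂ) :
    star (u z) = u (-(starRingEnd ℂ z)) := by
  have h_eq : ∀ a : A, φ (a * star (u z)) = φ (a * u (-(starRingEnd ℂ z))) := by
    intro a
    have h_adj : ∀ w : ℂ, φ (a * star (u w)) = starRingEnd ℂ (φ (u w * star a)) := fun w => by
      rw [← map_star_of_nonneg φ hpos, star_mul, star_star]
    have h_diff : Differentiable ℂ fun w : ℂ => φ (a * star (u (-(starRingEnd ℂ w)))) := by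
      simp only [h_adj]
      have h_neg : Differentiable ℂ fun w : ℂ => φ (u (-w) * star a) :=
        (hu.entire_right (star a)).comp differentiable_neg
      exact fun w => differentiableAt_conj_conj_iff.mpr (h_neg _)
    have h_fun := h_diff.eq_of_eq_ofReal (hu.entire_left a) fun t => by
      rw [Complex.conj_ofReal, hu.star_neg_ofReal]
    simpa using congrFun h_fun (-(starRingEnd ℂ z))
  refine sub_eq_zero.mp (hfaith _ ?_)
  rw [mul_sub, map_sub, h_eq, sub_self]
end
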